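/- If b, m, n are positive integers not divisible by p, and c = b·p^r where k < r < j + k, then σ_{ψ,ε}(m,n;c) = 0. -/

import Mathlib

open Complex Finset

noncomputable def eZMod (c : ℕ) (z : ZMod c) : ℂ :=
  Complex.exp (2 * Real.pi * Complex.I * (z.val : ℂ) / (c : ℂ))

/-- Ordinary Kloosterman sum `S(m,n;c)`. -/
noncomputable def klooOrd (c : ℕ) [NeZero c] (m n : ZMod c) : ℂ :=
  ∑ x : (ZMod c)ˣ, eZMod c (m * (x : ZMod c) + n * ((x⁻¹ : (ZMod c)ˣ) : ZMod c))

/-- `S_{χ̄²}(m,n;c) = ∑_{x mod c, (x,c)=1} χ(x)² e_c(mx + n x̄)`, where `χ` is a character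
modulo `q` with `q ∣ c` and is evaluated at `x mod q`. -/
noncomputable def SChiSq (q c : ℕ) [NeZero c] (h : q ∣ c) (χ : DirichletCharacter ℂ q)
    (m n : ZMod c) : ℂ :=
  ∑ x : (ZMod c)ˣ, (χ (ZMod.castHom h (ZMod q) (x : ZMod c)))^2 *
    eZMod c (m * (x : ZMod c) + n * ((x⁻¹ : (ZMod c)ˣ) : ZMod c))

/-- The coset sum `σ_{ψ,ε}(m,n;c)`: the sum over the Dirichlet characters `χ` modulo `p^k`
in the coset `ψ·Ĝ_{p^j}` of `χ(m)·conj(χ(n))·(1 + ε·χ(-1))·S_{χ̄²}(m,n;c)`. -/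
noncomputable def cosetSum (p k j : ℕ) (hjk : j ≤ k) (ψ : DirichletCharacter ℂ (p^k))
    (ε : ℤ) (c : ℕ) [NeZero c] (hqc : p^k ∣ c) (m n : ZMod c) : ℂ :=
  ∑ χ' : DirichletCharacter ℂ (p^j),
    (ψ * DirichletCharacter.changeLevel (pow_dvd_pow p hjk) χ')
        (ZMod.castHom hqc (ZMod (p^k)) m) *
    (starRingEnd ℂ) ((ψ * DirichletCharacter.changeLevel (pow_dvd_pow p hjk) χ')
        (ZMod.castHom hqc (ZMod (p^k)) n)) *
    (1 + (ε : ℂ) * (ψ * DirichletCharacter.changeLevel (pow_dvd_pow p hjk) χ') (-1)) *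
    SChiSq (p^k) c hqc (ψ * DirichletCharacter.changeLevel (pow_dvd_pow p hjk) χ') m n

/-- The sums `K_ψ^±(m,n;p^r)` (the sign `±` is the parameter `s`): the sum of
`ψ(x)² e_{p^r}(mx + n x̄)` over `x mod p^r`, `p ∤ x`, with `m x² ≡ s·n (mod p^j)`. -/
noncomputable def Kpm (p k j r : ℕ) [NeZero (p^r)] (hkr : k ≤ r) (hjr : j ≤ r)
    (ψ : DirichletCharacter ℂ (p^k)) (s : ℤ) (m n : ZMod (p^r)) : ℂ :=
  ∑ x ∈ Finset.univ.filter (fun x : (ZMod (p^r))ˣ =>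
      ZMod.castHom (pow_dvd_pow p hjr) (ZMod (p^j)) (m * (x : ZMod (p^r))^2)
        = (s : ZMod (p^j)) * ZMod.castHom (pow_dvd_pow p hjr) (ZMod (p^j)) n),
    (ψ (ZMod.castHom (pow_dvd_pow p hkr) (ZMod (p^k)) (x : ZMod (p^r))))^2 *
      eZMod (p^r) (m * (x : ZMod (p^r)) + n * ((x⁻¹ : (ZMod (p^r))ˣ) : ZMod (p^r)))

section Shifts

variable {G : Type*} [Group G] [Fintype G]

lemma sum_eq_zero_of_map_mul_right {F : G → ℂ} (u : G) {z : ℂ} (hz : z ≠ 1)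
    (h : ∀ x, F (x * u) = z * F x) : ∑ x, F x = 0 := by
  have hsum : ∑ x, F x = z * ∑ x, F x := by
    rw [Finset.mul_sum, ← Equiv.sum_comp (Equiv.mulRight u) F]
    exact Finset.sum_congr rfl fun x _ => h x
  have : (z - 1) * ∑ x, F x = 0 := by linear_combination -hsum
  exact (mul_eq_zero.mp this).resolve_left (sub_ne_zero.mpr hz)

lemma sum_eq_zero_of_map_mul_right_pow {F : G → ℂ} {p : ℕ} (hp : p ≠ 0) (u : ℕ → G) (ζ : G → ℂ)
    (hζ : ∀ x, F x ≠ 0 → ζ x ≠ 1) (hζp : ∀ x, ζ x ^ p = 1)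
    (h : ∀ t x, F (x * u t) = ζ x ^ t * F x) : ∑ x, F x = 0 := by
  have hsum : ∀ t, ∑ x, F x = ∑ x, ζ x ^ t * F x := fun t => by
    rw [← Equiv.sum_comp (Equiv.mulRight (u t)) F]
    exact Finset.sum_congr rfl fun x _ => h t x
  have hp' : (p : ℂ) * ∑ x, F x = 0 := by
    calc (p : ℂ) * ∑ x, F x = ∑ t ∈ Finset.range p, ∑ x, ζ x ^ t * F x := by
          rw [← Finset.sum_congr rfl fun t _ => hsum t]; simp
      _ = ∑ x, (∑ t ∈ Finset.range p, ζ x ^ t) * F x := by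
          rw [Finset.sum_comm]; simp_rw [Finset.sum_mul]
      _ = 0 := Finset.sum_eq_zero fun x _ => by
          by_cases hx : F x = 0
          · simp [hx]
          · rw [geom_sum_eq (hζ x hx), hζp]; simp
  exact (mul_eq_zero.mp hp').resolve_left (Nat.cast_ne_zero.mpr hp)

end Shifts

/-- The unit `1 + w`, with inverse `1 - w`, attached to an element `w` of square zero. -/
def oneAddUnit {R : Type*} [CommRing R] (w : R) (hw : w * w = 0) : Rˣ where
  val := 1 + w
  inv := 1 - w
  val_inv := by linear_combination -hw
  inv_val := by linear_combination -hw

section ZMod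

variable {c : ℕ}

lemma castHom_natCast_eq_zero {d : ℕ} (hd : d ∣ c) {a : ℕ} (ha : d ∣ a) :
    ZMod.castHom hd (ZMod d) (a : ZMod c) = 0 := by
  rw [map_natCast, ZMod.natCast_eq_zero_iff]; exact ha

/-- The condition `n ≡ m x² (mod d)` is invariant under `x ↦ x (1 + w)` when `d ∣ w`. -/
lemma castHom_mul_sq_mul_oneAddUnit {d : ℕ} (hd : d ∣ c) (m : ZMod c) (x : (ZMod c)ˣ)
    (w : ZMod c) (hw : w * w = 0) (hwd : ZMod.castHom hd (ZMod d) w = 0) :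
    ZMod.castHom hd (ZMod d) (m * ((x * oneAddUnit w hw : (ZMod c)ˣ) : ZMod c) ^ 2) =
      ZMod.castHom hd (ZMod d) (m * (x : ZMod c) ^ 2) := by
  have h1 : ((oneAddUnit w hw : (ZMod c)ˣ) : ZMod c) = 1 + w := rfl
  rw [Units.val_mul, h1]
  simp only [map_mul, map_pow, map_add, map_one, hwd]
  ring

variable [NeZero c]

lemma eZMod_eq_stdAddChar (z : ZMod c) : eZMod c z = ZMod.stdAddChar z := by
  rw [ZMod.stdAddChar_apply, ZMod.toCircle_apply, eZMod]

lemma exists_eq_natCast_mul_of_castHom_eq_zero {d : ℕ} (hd : d ∣ c) {z : ZMod c}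
    (hz : ZMod.castHom hd (ZMod d) z = 0) : ∃ y : ZMod c, z = d * y := by
  rw [← ZMod.natCast_zmod_val z, map_natCast, ZMod.natCast_eq_zero_iff] at hz
  obtain ⟨y, hy⟩ := hz
  exact ⟨y, by rw [← ZMod.natCast_zmod_val z, hy, Nat.cast_mul]⟩

/-- The summand `χ(x)² e_c(mx + n x̄)` of `SChiSq`. -/
noncomputable def klooTerm {q : ℕ} (h : q ∣ c) (χ : DirichletCharacter ℂ q) (m n : ZMod c)
    (x : (ZMod c)ˣ) : ℂ :=
  (χ (ZMod.castHom h (ZMod q) (x : ZMod c)))^2 *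
    eZMod c (m * (x : ZMod c) + n * ((x⁻¹ : (ZMod c)ˣ) : ZMod c))

lemma klooTerm_mul_oneAddUnit {q : ℕ} (h : q ∣ c) (χ : DirichletCharacter ℂ q) (m n : ZMod c)
    (x : (ZMod c)ˣ) (w : ZMod c) (hw : w * w = 0) :
    klooTerm h χ m n (x * oneAddUnit w hw) =
      χ (1 + ZMod.castHom h (ZMod q) w) ^ 2 *
        ZMod.stdAddChar (w * (m * (x : ZMod c) - n * ((x⁻¹ : (ZMod c)ˣ) : ZMod c))) *
        klooTerm h χ m n x := by
  have h1 : ((oneAddUnit w hw : (ZMod c)ˣ) : ZMod c) = 1 + w := rfl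
  have h2 : (((oneAddUnit w hw)⁻¹ : (ZMod c)ˣ) : ZMod c) = 1 - w := rfl
  have h3 : m * ((x : ZMod c) * (1 + w)) + n * ((((x⁻¹ : (ZMod c)ˣ) : ZMod c)) * (1 - w)) =
      w * (m * (x : ZMod c) - n * ((x⁻¹ : (ZMod c)ˣ) : ZMod c)) +
        (m * (x : ZMod c) + n * ((x⁻¹ : (ZMod c)ˣ) : ZMod c)) := by ring
  simp only [klooTerm, eZMod_eq_stdAddChar, mul_inv, Units.val_mul, h1, h2, h3,
    AddChar.map_add_eq_mul, map_mul, map_add, map_one]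
  ring

end ZMod

/-- A primitive character modulo `p ^ k` is nontrivial on some `1 + p ^ (k - 1) b z`. -/
lemma exists_char_one_add_ne_one {p k b : ℕ} (hp : p.Prime) (hk : 1 ≤ k) (hpb : ¬ p ∣ b)
    (χ : DirichletCharacter ℂ (p ^ k)) (hχ : χ.conductor = p ^ k) :
    ∃ z : ℕ, χ (1 + ((b * p ^ (k - 1) * z : ℕ) : ZMod (p ^ k))) ≠ 1 := by
  have : NeZero (p ^ k) := ⟨pow_ne_zero _ hp.ne_zero⟩
  have hd : p ^ (k - 1) ∣ p ^ k := pow_dvd_pow p (Nat.sub_le k 1)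
  by_contra! hall
  have hfac : χ.FactorsThrough (p ^ (k - 1)) := by
    rw [DirichletCharacter.factorsThrough_iff_ker_unitsMap hd]
    intro u hu
    rw [MonoidHom.mem_ker, Units.ext_iff, ZMod.unitsMap_val, Units.val_one] at hu
    have hu' : ZMod.castHom hd (ZMod (p ^ (k - 1))) ((u : ZMod (p ^ k)) - 1) = 0 := by
      rw [map_sub, map_one, ZMod.castHom_apply, hu, sub_self]
    obtain ⟨t, ht⟩ := exists_eq_natCast_mul_of_castHom_eq_zero hd hu'
    have hb : ((b : ℕ) : ZMod (p ^ k)) * (b : ZMod (p ^ k))⁻¹ = 1 :=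
      ZMod.coe_mul_inv_eq_one b (((hp.coprime_iff_not_dvd.mpr hpb).symm).pow_right k)
    have hval := hall ((b : ZMod (p ^ k))⁻¹ * t).val
    rw [MonoidHom.mem_ker, Units.ext_iff, MulChar.coe_toUnitHom, Units.val_one, ← hval]
    congr 1
    push_cast [ZMod.natCast_zmod_val] at ht ⊢
    linear_combination ht - (p : ZMod (p ^ k)) ^ (k - 1) * t * hb
  have hle : χ.conductor ≤ p ^ (k - 1) := Nat.sInf_le hfac
  rw [hχ] at hle
  exact absurd hle (not_le.mpr (Nat.pow_lt_pow_right hp.one_lt (by omega)))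

section Vanishing

variable {p k j b r c : ℕ} [NeZero c]

lemma sum_klooTerm_eq_zero_of_sq_eq (hp : p.Prime) (hjk : j < k) (hpb : ¬ p ∣ b)
    (hrjk : r < j + k) (hc : c = b * p ^ r) (hqc : p ^ k ∣ c) (hjc : p ^ j ∣ c)
    (ψ : DirichletCharacter ℂ (p ^ k)) (hψ : (ψ ^ 2).conductor = p ^ k) (m n : ZMod c) :
    ∑ x : (ZMod c)ˣ, klooTerm hqc ψ m n x *
      (if ZMod.castHom hjc (ZMod (p ^ j)) n =
        ZMod.castHom hjc (ZMod (p ^ j)) (m * (x : ZMod c) ^ 2) then 1 else 0) = 0 := by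
  obtain ⟨z, hz⟩ := exists_char_one_add_ne_one hp (by omega) hpb _ hψ
  have hzero : ∀ a : ℕ, c ∣ a → (a : ZMod c) = 0 := fun a => (ZMod.natCast_eq_zero_iff a c).mpr
  set w : ZMod c := ((b * p ^ (k - 1) * z : ℕ) : ZMod c) with hw
  have hww : w * w = 0 := by
    rw [hw, ← Nat.cast_mul]
    refine hzero _ ?_
    rw [hc, show b * p ^ (k - 1) * z * (b * p ^ (k - 1) * z) =
      b * p ^ (k - 1 + (k - 1)) * (b * z * z) by rw [pow_add]; ring]
    exact Dvd.dvd.mul_right (mul_dvd_mul_left b (pow_dvd_pow p (by omega))) _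
  have hwj : ZMod.castHom hjc (ZMod (p ^ j)) w = 0 :=
    castHom_natCast_eq_zero hjc
      (((pow_dvd_pow p (by omega : j ≤ k - 1)).mul_left b).mul_right z)
  refine sum_eq_zero_of_map_mul_right (oneAddUnit w hww) hz fun x => ?_
  rw [castHom_mul_sq_mul_oneAddUnit hjc m x w hww hwj, klooTerm_mul_oneAddUnit]
  split_ifs with hx
  · obtain ⟨y, hy⟩ := exists_eq_natCast_mul_of_castHom_eq_zero hjc
      (show ZMod.castHom hjc (ZMod (p ^ j)) (m * (x : ZMod c) ^ 2 - n) = 0 by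
        rw [map_sub, hx, sub_self])
    have hxx : (x : ZMod c) * ((x⁻¹ : (ZMod c)ˣ) : ZMod c) = 1 := Units.mul_inv x
    have hphase : w * (m * (x : ZMod c) - n * ((x⁻¹ : (ZMod c)ˣ) : ZMod c)) = 0 := by
      have hwp : w * ((p ^ j : ℕ) : ZMod c) = 0 := by
        rw [hw, ← Nat.cast_mul]
        refine hzero _ ?_
        rw [hc, show b * p ^ (k - 1) * z * p ^ j = b * p ^ (k - 1 + j) * z by rw [pow_add]; ring]
        exact Dvd.dvd.mul_right (mul_dvd_mul_left b (pow_dvd_pow p (by omega))) _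
      linear_combination w * ((x⁻¹ : (ZMod c)ˣ) : ZMod c) * hy - w * m * x * hxx +
        y * ((x⁻¹ : (ZMod c)ˣ) : ZMod c) * hwp
    rw [hphase, AddChar.map_zero_eq_one, hw, map_natCast, MulChar.pow_apply' _ two_ne_zero]
    ring
  · simp

lemma sum_klooTerm_eq_zero_of_sq_eq_neg (hp : p.Prime) (hodd : Odd p) (hj : 1 ≤ j) (hjk : j ≤ k)
    (hkr : k < r) (hr : 2 ≤ r) (hb : 0 < b)
    (hc : c = b * p ^ r) (hqc : p ^ k ∣ c) (hjc : p ^ j ∣ c)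
    (ψ : DirichletCharacter ℂ (p ^ k)) (m n : ℕ) (hpn : ¬ p ∣ n) :
    ∑ x : (ZMod c)ˣ, klooTerm hqc ψ m n x *
      (if ZMod.castHom hjc (ZMod (p ^ j)) n =
        -ZMod.castHom hjc (ZMod (p ^ j)) (m * (x : ZMod c) ^ 2) then 1 else 0) = 0 := by
  have hzero : ∀ a : ℕ, c ∣ a → (a : ZMod c) = 0 := fun a => (ZMod.natCast_eq_zero_iff a c).mpr
  have hww : ∀ t : ℕ, ((b * p ^ (r - 1) * t : ℕ) : ZMod c) * ((b * p ^ (r - 1) * t : ℕ) : ZMod c)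
      = 0 := fun t => by
    rw [← Nat.cast_mul]
    refine hzero _ ?_
    rw [hc, show b * p ^ (r - 1) * t * (b * p ^ (r - 1) * t) =
      b * p ^ (r - 1 + (r - 1)) * (b * t * t) by rw [pow_add]; ring]
    exact Dvd.dvd.mul_right (mul_dvd_mul_left b (pow_dvd_pow p (by omega))) _
  have hwi : ∀ {i : ℕ} (hi : i ≤ r - 1) (hic : p ^ i ∣ c) (t : ℕ),
      ZMod.castHom hic (ZMod (p ^ i)) ((b * p ^ (r - 1) * t : ℕ) : ZMod c) = 0 :=
    fun hi hic t => castHom_natCast_eq_zero hic (((pow_dvd_pow p hi).mul_left b).mul_right t)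
  have hcp : c = b * p ^ (r - 1) * p := by
    rw [hc, mul_assoc, ← pow_succ, Nat.sub_add_cancel (by omega)]
  refine sum_eq_zero_of_map_mul_right_pow hp.ne_zero (fun t => oneAddUnit _ (hww t))
    (fun x : (ZMod c)ˣ => ZMod.stdAddChar (((b * p ^ (r - 1) : ℕ) : ZMod c) *
      ((m : ZMod c) * (x : ZMod c) - (n : ZMod c) * ((x⁻¹ : (ZMod c)ˣ) : ZMod c)))) (fun x hx hone => ?_) (fun x => ?_)
    (fun t x => ?_)
  · have hcond := (ite_ne_right_iff.mp (right_ne_zero_of_mul hx)).1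
    rw [← AddChar.map_zero_eq_one (ZMod.stdAddChar (N := c)),
      ZMod.injective_stdAddChar.eq_iff] at hone
    have : Fact p.Prime := ⟨hp⟩
    have hpc : p ∣ c := hcp ▸ dvd_mul_left p _
    set y : ZMod c := (m : ZMod c) * (x : ZMod c) - (n : ZMod c) * ((x⁻¹ : (ZMod c)ˣ) : ZMod c) with hy
    have hpy : ZMod.castHom hpc (ZMod p) y = 0 := by
      rw [← ZMod.natCast_zmod_val y, ← Nat.cast_mul, ZMod.natCast_eq_zero_iff] at hone
      rw [← ZMod.natCast_zmod_val y]
      refine castHom_natCast_eq_zero hpc ?_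
      nth_rw 1 [hcp] at hone
      exact Nat.dvd_of_mul_dvd_mul_left (Nat.mul_pos hb (pow_pos hp.pos _)) hone
    have hpj : p ∣ p ^ j := dvd_pow_self p (by omega)
    have hcond' : ZMod.castHom hpc (ZMod p) (n : ZMod c) =
        -ZMod.castHom hpc (ZMod p) (m * (x : ZMod c) ^ 2) := by
      have hcomp : (ZMod.castHom hpj (ZMod p)).comp (ZMod.castHom hjc (ZMod (p ^ j))) =
          ZMod.castHom hpc (ZMod p) := Subsingleton.elim _ _
      rw [← hcomp, RingHom.comp_apply, RingHom.comp_apply, hcond, map_neg]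
    have hsq : ZMod.castHom hpc (ZMod p) (m * (x : ZMod c) ^ 2) =
        ZMod.castHom hpc (ZMod p) (n : ZMod c) := by
      rw [← sub_eq_zero, ← map_sub, show (m : ZMod c) * (x : ZMod c) ^ 2 - n = x * y by
        rw [hy]; linear_combination (n : ZMod c) * Units.mul_inv x, map_mul, hpy, mul_zero]
    rw [hsq, map_natCast] at hcond'
    have h2n : ((2 * n : ℕ) : ZMod p) = 0 := by
      push_cast; linear_combination hcond'
    rw [ZMod.natCast_eq_zero_iff, hp.dvd_mul] at h2n
    rcases h2n with h2 | h2
    · rw [(Nat.prime_dvd_prime_iff_eq hp Nat.prime_two).mp h2] at hodd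
      exact absurd hodd (by decide)
    · exact hpn h2
  · rw [← AddChar.map_nsmul_eq_pow, nsmul_eq_mul, ← mul_assoc, ← Nat.cast_mul, mul_comm p, ← hcp,
      ZMod.natCast_self, zero_mul, AddChar.map_zero_eq_one]
  · rw [castHom_mul_sq_mul_oneAddUnit hjc _ x _ (hww t) (hwi (by omega) hjc t),
      klooTerm_mul_oneAddUnit, hwi (by omega) hqc t, add_zero, map_one, one_pow, one_mul,
      ← AddChar.map_nsmul_eq_pow, nsmul_eq_mul, mul_assoc]
    congr 2
    push_cast
    ring

end Vanishing

lemma conj_mul_sum_char_eq {d : ℕ} [NeZero d] {a : ZMod d} (ha : IsUnit a) (e : ZMod d) :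
    ∑ χ : DirichletCharacter ℂ d, (starRingEnd ℂ) (χ a) * χ e =
      if a = e then (d.totient : ℂ) else 0 := by
  rw [← DirichletCharacter.sum_char_inv_mul_char_eq ℂ ha e]
  refine Finset.sum_congr rfl fun χ _ => ?_
  obtain ⟨u, rfl⟩ := ha
  rw [starRingEnd_apply, MulChar.star_apply', MulChar.inv_apply, Ring.inverse_unit,
    ZMod.inv_coe_unit]

lemma changeLevel_castHom {c q d : ℕ} (hqc : q ∣ c) (hdq : d ∣ q) (χ : DirichletCharacter ℂ d)
    {z : ZMod c} (hz : IsUnit (ZMod.castHom hqc (ZMod q) z)) :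
    DirichletCharacter.changeLevel hdq χ (ZMod.castHom hqc (ZMod q) z) =
      χ (ZMod.castHom (hdq.trans hqc) (ZMod d) z) := by
  have hcomp : (ZMod.castHom hdq (ZMod d)).comp (ZMod.castHom hqc (ZMod q)) =
      ZMod.castHom (hdq.trans hqc) (ZMod d) := Subsingleton.elim _ _
  rw [← hcomp, RingHom.comp_apply]
  obtain ⟨u, hu⟩ := hz
  rw [← hu, DirichletCharacter.changeLevel_eq_cast_of_dvd, ZMod.castHom_apply]

/-- the coset sum vanishes for `c = b·p^r` with `k < r < j + k`. -/
theorem cosetSum_eq_zero (p : ℕ) (hp : p.Prime) (hodd : Odd p)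
    (k : ℕ) (hk : 2 ≤ k) (j : ℕ) (hj : 1 ≤ j) (hjk : j < k)
    (ψ : DirichletCharacter ℂ (p^k)) (hψ : (ψ^2).conductor = p^k)
    (ε : ℤ) (hε : ε = 1 ∨ ε = -1)
    (b m n : ℕ) (hb : 0 < b) (hm : 0 < m) (hn : 0 < n)
    (hpb : ¬ p ∣ b) (hpm : ¬ p ∣ m) (hpn : ¬ p ∣ n)
    (r : ℕ) (hkr : k < r) (hrjk : r < j + k)
    (c : ℕ) [NeZero c] (hc : c = b * p ^ r) (hqc : p ^ k ∣ c) :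
    cosetSum p k j hjk.le ψ ε c hqc (m : ZMod c) (n : ZMod c) = 0 := by
  have hpj0 : NeZero (p ^ j) := ⟨pow_ne_zero _ hp.ne_zero⟩
  have hdq : p ^ j ∣ p ^ k := pow_dvd_pow p hjk.le
  have hjc : p ^ j ∣ c := hdq.trans hqc
  have hunit : ∀ {a : ℕ}, ¬ p ∣ a → ∀ {i : ℕ} (hi : p ^ i ∣ c),
      IsUnit (ZMod.castHom hi (ZMod (p ^ i)) (a : ZMod c)) := fun {a} ha {i} hi => by
    rw [map_natCast, ZMod.isUnit_iff_coprime]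
    exact ((hp.coprime_iff_not_dvd.mpr ha).symm).pow_right i
  have hunit' : ∀ (x : (ZMod c)ˣ), IsUnit (ZMod.castHom hqc (ZMod (p ^ k)) (x : ZMod c)) :=
    fun x => x.isUnit.map _
  have hneg : ∀ χ' : DirichletCharacter ℂ (p ^ j),
      DirichletCharacter.changeLevel hdq χ' (-1) = χ' (-1) := fun χ' => by
    have := changeLevel_castHom hqc hdq χ' (z := -1)
      (by rw [map_neg, map_one]; exact isUnit_one.neg)
    simpa only [RingHom.map_neg, RingHom.map_one] using this
  set A : ℂ := ψ (ZMod.castHom hqc (ZMod (p ^ k)) m) *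
    (starRingEnd ℂ) (ψ (ZMod.castHom hqc (ZMod (p ^ k)) n)) with hA
  set ρ := ZMod.castHom hjc (ZMod (p ^ j)) with hρ
  calc cosetSum p k j hjk.le ψ ε c hqc (m : ZMod c) (n : ZMod c)
      = ∑ χ' : DirichletCharacter ℂ (p ^ j), ∑ x : (ZMod c)ˣ, A * klooTerm hqc ψ m n x *
          ((starRingEnd ℂ) (χ' (ρ n)) * χ' (ρ (m * (x : ZMod c) ^ 2)) +
            ε * ψ (-1) * ((starRingEnd ℂ) (χ' (ρ n)) * χ' (-ρ (m * (x : ZMod c) ^ 2)))) := by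
        refine Finset.sum_congr rfl fun χ' _ => ?_
        rw [SChiSq, Finset.mul_sum]
        refine Finset.sum_congr rfl fun x _ => ?_
        simp only [MulChar.mul_apply, hneg, changeLevel_castHom hqc hdq χ' (hunit hpm hqc),
          changeLevel_castHom hqc hdq χ' (hunit hpn hqc),
          changeLevel_castHom hqc hdq χ' (hunit' x), klooTerm, hA]
        rw [neg_eq_neg_one_mul (ρ _)]
        simp only [map_mul, map_pow, ← hρ]
        ring
    _ = ∑ x : (ZMod c)ˣ, A * klooTerm hqc ψ m n x *
          ((if ρ n = ρ (m * (x : ZMod c) ^ 2) then ((p ^ j).totient : ℂ) else 0) +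
            ε * ψ (-1) *
              (if ρ n = -ρ (m * (x : ZMod c) ^ 2) then ((p ^ j).totient : ℂ) else 0)) := by
        rw [Finset.sum_comm]
        simp only [← conj_mul_sum_char_eq (hunit hpn hjc), ← Finset.mul_sum,
          Finset.sum_add_distrib, hρ]
    _ = A * (p ^ j).totient * (∑ x : (ZMod c)ˣ, klooTerm hqc ψ m n x *
          (if ρ n = ρ (m * (x : ZMod c) ^ 2) then 1 else 0)) +
        A * (p ^ j).totient * ε * ψ (-1) * (∑ x : (ZMod c)ˣ, klooTerm hqc ψ m n x *
          (if ρ n = -ρ (m * (x : ZMod c) ^ 2) then 1 else 0)) := by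
        rw [Finset.mul_sum, Finset.mul_sum, ← Finset.sum_add_distrib]
        refine Finset.sum_congr rfl fun x _ => ?_
        split_ifs <;> ring
    _ = 0 := by
        rw [hρ, sum_klooTerm_eq_zero_of_sq_eq hp hjk hpb hrjk hc hqc hjc ψ hψ,
          sum_klooTerm_eq_zero_of_sq_eq_neg hp hodd hj hjk.le hkr (by omega) hb hc hqc hjc ψ m n
            hpn]
        simp
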